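/- Glivenko's Theorem for the conjunction-negation fragment: let Γ ∪ {φ} ⊆ 𝔉_{{∧,¬}} (formulas built from letters using only ∧ and ¬). If Γ ⊢_c ¬φ (¬φ is a classical consequence of Γ), then Γ ⊢_{{∧,¬}} ¬φ (¬φ is derivable from Γ in the {∧,¬}-fragment of intuitionistic logic). -/

import Mathlib

/-- The four propositional connectives. -/
inductive Conn : Type
  | conj | disj | impl | nega
deriving DecidableEq

/-- Propositional formulas over countably many letters `p₀, p₁, …`. -/
inductive PropForm : Type
  | var : ℕ → PropForm
  | and : PropForm → PropForm → PropForm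
  | or : PropForm → PropForm → PropForm
  | imp : PropForm → PropForm → PropForm
  | neg : PropForm → PropForm

/-- The set of connectives occurring in a formula. -/
def PropForm.conns : PropForm → Set Conn
  | .var _ => ∅
  | .and a b => insert .conj (a.conns ∪ b.conns)
  | .or a b => insert .disj (a.conns ∪ b.conns)
  | .imp a b => insert .impl (a.conns ∪ b.conns)
  | .neg a => insert .nega a.conns

/-- `φ ∈ 𝔉_F` : the formula `φ` uses only connectives belonging to the fragment `F`. -/
def InFrag (F : Set Conn) (φ : PropForm) : Prop := φ.conns ⊆ F

/-- Derivability `Γ ⊢_F φ` for the fragment `F`: the least relation closed under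
membership, monotonicity, cut, and the two directions of the rules
(R∧), (R∨), (R→), (R¬I), (R¬E) for the connectives in `F`. -/
inductive Deriv (F : Set Conn) : Set PropForm → PropForm → Prop
  | mem {Γ : Set PropForm} {φ : PropForm} : φ ∈ Γ → Deriv F Γ φ
  | mono {Γ : Set PropForm} {φ ψ : PropForm} : Deriv F Γ φ → Deriv F (insert ψ Γ) φ
  | cut {Γ Δ : Set PropForm} {φ ψ : PropForm} :
      Deriv F Γ φ → Deriv F (insert φ Δ) ψ → Deriv F (Γ ∪ Δ) ψ
  | andI {Γ : Set PropForm} {φ ψ : PropForm} :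
      Conn.conj ∈ F → Deriv F Γ φ → Deriv F Γ ψ → Deriv F Γ (.and φ ψ)
  | andE1 {Γ : Set PropForm} {φ ψ : PropForm} :
      Conn.conj ∈ F → Deriv F Γ (.and φ ψ) → Deriv F Γ φ
  | andE2 {Γ : Set PropForm} {φ ψ : PropForm} :
      Conn.conj ∈ F → Deriv F Γ (.and φ ψ) → Deriv F Γ ψ
  | orI {Γ : Set PropForm} {φ ψ χ : PropForm} :
      Conn.disj ∈ F → Deriv F (insert φ Γ) χ → Deriv F (insert ψ Γ) χ →
      Deriv F (insert (.or φ ψ) Γ) χ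
  | orE1 {Γ : Set PropForm} {φ ψ χ : PropForm} :
      Conn.disj ∈ F → Deriv F (insert (.or φ ψ) Γ) χ → Deriv F (insert φ Γ) χ
  | orE2 {Γ : Set PropForm} {φ ψ χ : PropForm} :
      Conn.disj ∈ F → Deriv F (insert (.or φ ψ) Γ) χ → Deriv F (insert ψ Γ) χ
  | impI {Γ : Set PropForm} {φ ψ : PropForm} :
      Conn.impl ∈ F → Deriv F (insert φ Γ) ψ → Deriv F Γ (.imp φ ψ)
  | impE {Γ : Set PropForm} {φ ψ : PropForm} :
      Conn.impl ∈ F → Deriv F Γ (.imp φ ψ) → Deriv F (insert φ Γ) ψ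
  | negI {Γ : Set PropForm} {φ ψ : PropForm} :
      Conn.nega ∈ F → Deriv F (insert φ Γ) ψ → Deriv F (insert φ Γ) (.neg ψ) →
      Deriv F Γ (.neg φ)
  | negE {Γ : Set PropForm} {φ ψ : PropForm} :
      Conn.nega ∈ F → Deriv F Γ φ → Deriv F Γ (.neg φ) → Deriv F Γ ψ

/-- An algebra interpreting the connectives on a carrier `V`. -/
structure Alg (V : Type) where
  and : V → V → V
  or : V → V → V
  imp : V → V → V
  neg : V → V

/-- The homomorphic extension of an assignment `v` of letters. -/
def Alg.eval {V : Type} (A : Alg V) (v : ℕ → V) : PropForm → V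
  | .var n => v n
  | .and a b => A.and (A.eval v a) (A.eval v b)
  | .or a b => A.or (A.eval v a) (A.eval v b)
  | .imp a b => A.imp (A.eval v a) (A.eval v b)
  | .neg a => A.neg (A.eval v a)

/-- Semantic consequence `Γ ⊨_{A,D} φ`. -/
def SemConseq {V : Type} (A : Alg V) (D : Set V) (Γ : Set PropForm) (φ : PropForm) : Prop :=
  ∀ v : ℕ → V, (∀ ψ ∈ Γ, A.eval v ψ ∈ D) → A.eval v φ ∈ D

/-- The fragment `F` has a finite semantics. -/
def HasFiniteSemantics (F : Set Conn) : Prop :=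
  ∃ (V : Type) (_ : Fintype V) (A : Alg V) (D : Set V),
    ∀ (Γ : Set PropForm) (φ : PropForm),
      (∀ ψ ∈ Γ, InFrag F ψ) → InFrag F φ →
      (Deriv F Γ φ ↔ SemConseq A D Γ φ)

/-- `φ ∨̇ ψ = (φ → ψ) → ψ`. -/
def dvee (a b : PropForm) : PropForm := .imp (.imp a b) b

/-- Left-associated iterated `∨̇` of a list of formulas. -/
def bigDvee : List PropForm → PropForm
  | [] => .var 0
  | a :: rest => rest.foldl dvee a

/-- Left-associated iterated `∨` of a list of formulas. -/
def bigOrF : List PropForm → PropForm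
  | [] => .var 0
  | a :: rest => rest.foldl PropForm.or a

/-- All pairs `(i, j)` with `1 ≤ i < j ≤ n+1`. -/
def pairs (n : ℕ) : List (ℕ × ℕ) :=
  (List.range' 2 n).flatMap fun j => (List.range' 1 (j - 1)).map fun i => (i, j)

/-- `α_n = ∨̇_{1 ≤ i < j ≤ n+1} (p_j → p_i)`. -/
def alphaImp (n : ℕ) : PropForm :=
  bigDvee ((pairs n).map fun p => .imp (.var p.2) (.var p.1))

/-- `α_n = ⋁_{1 ≤ i < j ≤ n+1} ¬¬(¬p_i ∨ p_j)`. -/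
def alphaOrNeg (n : ℕ) : PropForm :=
  bigOrF ((pairs n).map fun p => .neg (.neg (.or (.neg (.var p.1)) (.var p.2))))

/-- Two-valued Boolean evaluation. -/
def evalBool (v : ℕ → Bool) : PropForm → Bool
  | .var n => v n
  | .and a b => evalBool v a && evalBool v b
  | .or a b => evalBool v a || evalBool v b
  | .imp a b => !evalBool v a || evalBool v b
  | .neg a => !evalBool v a

/-- Classical (two-valued) consequence `Γ ⊢_c φ`. -/
def ClassConseq (Γ : Set PropForm) (φ : PropForm) : Prop :=
  ∀ v : ℕ → Bool, (∀ ψ ∈ Γ, evalBool v ψ = true) → evalBool v φ = true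

/-- The two-element Boolean algebra `𝟐`. -/
def alg2 : Alg Bool where
  and a b := a && b
  or a b := a || b
  imp a b := !a || b
  neg a := !a

/-- The three-element algebra `𝟑` on the chain `0 < 1/2 < 1` (coded as `0 < 1 < 2` in `Fin 3`),
with meet `min` and meet complement `¬0 = 1`, `¬(1/2) = ¬1 = 0` (its `or`/`imp` are those of the
3-element Heyting chain). -/
def alg3 : Alg (Fin 3) where
  and a b := min a b
  or a b := max a b
  imp a b := if a ≤ b then 2 else b
  neg a := if a = 0 then 2 else 0

/-- The `(n+1)`-element Heyting chain, coded on `Fin (n+1)` (so `k` codes the element `k+1`). -/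
def chainAlg (n : ℕ) : Alg (Fin (n + 1)) where
  and a b := min a b
  or a b := max a b
  imp a b := if a ≤ b then Fin.last n else b
  neg a := if a = 0 then Fin.last n else 0

namespace Deriv

variable {F : Set Conn} {Γ Δ : Set PropForm} {φ ψ : PropForm}

theorem weaken (h : Deriv F Γ φ) (hs : Γ ⊆ Δ) : Deriv F Δ φ := by
  have := cut (Δ := Δ) h (mem (Set.mem_insert φ Δ))
  rwa [Set.union_eq_self_of_subset_left hs] at this

theorem exists_finite_subset_of_insert
    (h : ∃ S ⊆ insert φ Γ, S.Finite ∧ Deriv F S ψ) :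
    ∃ S ⊆ Γ, S.Finite ∧ Deriv F (insert φ S) ψ := by
  obtain ⟨S, hS, hfin, hd⟩ := h
  refine ⟨S \ {φ}, by simpa [Set.sdiff_subset_iff] using hS, hfin.sdiff, hd.weaken ?_⟩
  simp [Set.subset_insert]

theorem exists_finite_subset (h : Deriv F Γ φ) :
    ∃ S ⊆ Γ, S.Finite ∧ Deriv F S φ := by
  induction h with
  | @mem Γ φ h => exact ⟨{φ}, by simpa using h, Set.finite_singleton φ, mem rfl⟩
  | mono _ ih =>
    obtain ⟨S, hS, hfin, hd⟩ := ih
    exact ⟨S, hS.trans (Set.subset_insert _ _), hfin, hd⟩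
  | cut _ _ ih₁ ih₂ =>
    obtain ⟨S, hS, hSfin, hd₁⟩ := ih₁
    obtain ⟨T, hT, hTfin, hd₂⟩ := exists_finite_subset_of_insert ih₂
    exact ⟨S ∪ T, Set.union_subset_union hS hT, hSfin.union hTfin, hd₁.cut hd₂⟩
  | andI hF _ _ ih₁ ih₂ =>
    obtain ⟨S, hS, hSfin, hd₁⟩ := ih₁
    obtain ⟨T, hT, hTfin, hd₂⟩ := ih₂
    exact ⟨S ∪ T, Set.union_subset hS hT, hSfin.union hTfin,
      andI hF (hd₁.weaken Set.subset_union_left) (hd₂.weaken Set.subset_union_right)⟩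
  | andE1 hF _ ih =>
    obtain ⟨S, hS, hfin, hd⟩ := ih
    exact ⟨S, hS, hfin, andE1 hF hd⟩
  | andE2 hF _ ih =>
    obtain ⟨S, hS, hfin, hd⟩ := ih
    exact ⟨S, hS, hfin, andE2 hF hd⟩
  | orI hF _ _ ih₁ ih₂ =>
    obtain ⟨S, hS, hSfin, hd₁⟩ := exists_finite_subset_of_insert ih₁
    obtain ⟨T, hT, hTfin, hd₂⟩ := exists_finite_subset_of_insert ih₂
    exact ⟨_, Set.insert_subset_insert (Set.union_subset hS hT), (hSfin.union hTfin).insert _,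
      orI hF (hd₁.weaken (Set.insert_subset_insert Set.subset_union_left))
        (hd₂.weaken (Set.insert_subset_insert Set.subset_union_right))⟩
  | orE1 hF _ ih =>
    obtain ⟨S, hS, hfin, hd⟩ := exists_finite_subset_of_insert ih
    exact ⟨_, Set.insert_subset_insert hS, hfin.insert _, orE1 hF hd⟩
  | orE2 hF _ ih =>
    obtain ⟨S, hS, hfin, hd⟩ := exists_finite_subset_of_insert ih
    exact ⟨_, Set.insert_subset_insert hS, hfin.insert _, orE2 hF hd⟩
  | impI hF _ ih =>
    obtain ⟨S, hS, hfin, hd⟩ := exists_finite_subset_of_insert ih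
    exact ⟨S, hS, hfin, impI hF hd⟩
  | impE hF _ ih =>
    obtain ⟨S, hS, hfin, hd⟩ := ih
    exact ⟨_, Set.insert_subset_insert hS, hfin.insert _, impE hF hd⟩
  | negI hF _ _ ih₁ ih₂ =>
    obtain ⟨S, hS, hSfin, hd₁⟩ := exists_finite_subset_of_insert ih₁
    obtain ⟨T, hT, hTfin, hd₂⟩ := exists_finite_subset_of_insert ih₂
    exact ⟨S ∪ T, Set.union_subset hS hT, hSfin.union hTfin,
      negI hF (hd₁.weaken (Set.insert_subset_insert Set.subset_union_left))
        (hd₂.weaken (Set.insert_subset_insert Set.subset_union_right))⟩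
  | negE hF _ _ ih₁ ih₂ =>
    obtain ⟨S, hS, hSfin, hd₁⟩ := ih₁
    obtain ⟨T, hT, hTfin, hd₂⟩ := ih₂
    exact ⟨S ∪ T, Set.union_subset hS hT, hSfin.union hTfin,
      negE hF (hd₁.weaken Set.subset_union_left) (hd₂.weaken Set.subset_union_right)⟩

/-- Lindenbaum's lemma. -/
theorem exists_maximal_not_deriv (h : ¬ Deriv F Γ φ) :
    ∃ Δ, Γ ⊆ Δ ∧ Maximal (fun Θ => ¬ Deriv F Θ φ) Δ := by
  refine zorn_subset_nonempty {Θ | ¬ Deriv F Θ φ} (fun c hc hchain hne => ?_) Γ h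
  refine ⟨⋃₀ c, fun hd => ?_, fun s => Set.subset_sUnion_of_mem⟩
  obtain ⟨S, hS, hfin, hd⟩ := hd.exists_finite_subset
  obtain ⟨Θ, hΘ, hSΘ⟩ :=
    hchain.directedOn.exists_mem_subset_of_finite_of_subset_sUnion hne hfin hS
  exact hc hΘ (hd.weaken hSΘ)

theorem mem_of_maximal (hΔ : Maximal (fun Θ => ¬ Deriv F Θ φ) Δ) (h : Deriv F Δ ψ) :
    ψ ∈ Δ :=
  hΔ.mem_of_prop_insert fun hd => hΔ.prop (by simpa using h.cut hd)

theorem neg_mem_iff_of_maximal (hn : Conn.nega ∈ F)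
    (hφ : ∀ Θ χ, Deriv F Θ φ → Deriv F Θ χ)
    (hΔ : Maximal (fun Θ => ¬ Deriv F Θ φ) Δ) : ψ.neg ∈ Δ ↔ ψ ∉ Δ := by
  refine ⟨fun h₁ h₂ => hΔ.prop (negE hn (mem h₂) (mem h₁)), fun h => ?_⟩
  have hd : Deriv F (insert ψ Δ) φ := by
    by_contra hd
    exact h (hΔ.mem_of_prop_insert hd)
  exact mem_of_maximal hΔ (negI hn (hφ _ ψ hd) (hφ _ ψ.neg hd))

theorem and_mem_iff_of_maximal {χ : PropForm} (hc : Conn.conj ∈ F)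
    (hΔ : Maximal (fun Θ => ¬ Deriv F Θ φ) Δ) : ψ.and χ ∈ Δ ↔ ψ ∈ Δ ∧ χ ∈ Δ :=
  ⟨fun h => ⟨mem_of_maximal hΔ (andE1 hc (mem h)), mem_of_maximal hΔ (andE2 hc (mem h))⟩,
    fun h => mem_of_maximal hΔ (andI hc (mem h.1) (mem h.2))⟩

end Deriv

theorem evalBool_eq_true_iff_mem {Δ : Set PropForm} {v : ℕ → Bool}
    (hvar : ∀ n, v n = true ↔ PropForm.var n ∈ Δ)
    (hand : ∀ ψ χ : PropForm, ψ.and χ ∈ Δ ↔ ψ ∈ Δ ∧ χ ∈ Δ)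
    (hneg : ∀ ψ : PropForm, ψ.neg ∈ Δ ↔ ψ ∉ Δ)
    {ψ : PropForm} (hψ : InFrag {Conn.conj, Conn.nega} ψ) :
    evalBool v ψ = true ↔ ψ ∈ Δ := by
  induction ψ with
  | var n => exact hvar n
  | and a b iha ihb =>
    obtain ⟨ha, hb⟩ := Set.union_subset_iff.1 ((Set.insert_subset_iff.1 hψ).2)
    simp [evalBool, hand, iha ha, ihb hb]
  | or a b => simpa using hψ (Set.mem_insert Conn.disj _)
  | imp a b => simpa using hψ (Set.mem_insert Conn.impl _)
  | neg a iha => simp [evalBool, hneg, ← iha (Set.insert_subset_iff.1 hψ).2]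

/-- Glivenko for `{∧, ¬}`: if `Γ ∪ {φ} ⊆ 𝔉_{∧,¬}` and `Γ ⊢_c ¬φ`,
then `Γ ⊢_{∧,¬} ¬φ`. -/
theorem glivenko_conj_neg (Γ : Set PropForm) (φ : PropForm)
    (hΓ : ∀ ψ ∈ Γ, InFrag {Conn.conj, Conn.nega} ψ) (hφ : InFrag {Conn.conj, Conn.nega} φ)
    (h : ClassConseq Γ (.neg φ)) :
    Deriv {Conn.conj, Conn.nega} Γ (.neg φ) := by
  have hc : Conn.conj ∈ ({Conn.conj, Conn.nega} : Set Conn) := by simp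
  have hn : Conn.nega ∈ ({Conn.conj, Conn.nega} : Set Conn) := by simp
  let bot : PropForm := .and (.var 0) (.neg (.var 0))
  have hbot : ∀ Θ χ, Deriv {Conn.conj, Conn.nega} Θ bot → Deriv {Conn.conj, Conn.nega} Θ χ :=
    fun _ _ hd => .negE hn (.andE1 hc hd) (.andE2 hc hd)
  by_contra hnd
  obtain ⟨Δ, hsub, hΔ⟩ := Deriv.exists_maximal_not_deriv
    (fun hd => hnd (.negI hn (hbot (insert φ Γ) φ hd) (hbot _ _ hd)))
  classical
  have key := fun {ψ} => evalBool_eq_true_iff_mem (Δ := Δ)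
    (v := fun n => decide (PropForm.var n ∈ Δ)) (ψ := ψ) (fun n => by simp)
    (fun _ _ => Deriv.and_mem_iff_of_maximal hc hΔ)
    (fun _ => Deriv.neg_mem_iff_of_maximal hn hbot hΔ)
  have hfalse := h _ fun ψ hψ => (key (hΓ ψ hψ)).2 (hsub (Set.mem_insert_of_mem φ hψ))
  simp [evalBool, (key hφ).2 (hsub (Set.mem_insert φ Γ))] at hfalse
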